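/- Let φ > 0, let μ be a measure on ℝ, and let b : ℝ → ℝ be twice differentiable with b''(s) ≤ U for all s ∈ ℝ, such that for every s ∈ ℝ the normalization ∫ exp((y·s − b(s))/φ) dμ(y) = 1 holds. Then for all θ, t ∈ ℝ: ∫ exp((y·θ − b(θ))/φ) · exp(t·(y − b'(θ))) dμ(y) ≤ exp(φ·U·t²/2). That is, a random variable Y with density exp((yθ − b(θ))/φ) with respect to μ is sub-Gaussian with variance proxy φU: E[exp(t(Y − b'(θ)))] ≤ exp(φUt²/2) for all t. -/

import Mathlib

open MeasureTheory

/-- A function whose second derivative is at most `U` lies below its second-order expansion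
with quadratic coefficient `U / 2`. -/
theorem le_quadratic_of_deriv2_le {b : ℝ → ℝ} {U : ℝ} (hb : Differentiable ℝ b)
    (hb' : Differentiable ℝ (deriv b)) (hU : ∀ s : ℝ, deriv (deriv b) s ≤ U) (θ s : ℝ) :
    b s ≤ b θ + deriv b θ * (s - θ) + U / 2 * (s - θ) ^ 2 := by
  have hg (x : ℝ) : HasDerivAt (fun x => U / 2 * x ^ 2 - b x) (U * x - deriv b x) x := by
    refine (((hasDerivAt_pow 2 x).const_mul (U / 2)).fun_sub (hb x).hasDerivAt).congr_deriv ?_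
    push_cast
    ring
  have hg' (x : ℝ) : HasDerivAt (fun x => U * x - deriv b x) (U - deriv (deriv b) x) x := by
    simpa using ((hasDerivAt_id x).const_mul U).fun_sub (hb' x).hasDerivAt
  have hmono : Monotone (fun x => U * x - deriv b x) :=
    monotone_of_hasDerivAt_nonneg hg' fun x => sub_nonneg.2 (hU x)
  have hconv : ConvexOn ℝ Set.univ (fun x => U / 2 * x ^ 2 - b x) := by
    refine Monotone.convexOn_univ_of_deriv (fun x => (hg x).differentiableAt) ?_
    rwa [funext fun x => (hg x).deriv]
  rcases lt_trichotomy θ s with h | rfl | h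
  · have := hconv.le_slope_of_hasDerivAt (Set.mem_univ _) (Set.mem_univ _) h (hg θ)
    rw [slope_def_field, le_div_iff₀ (sub_pos.2 h)] at this
    linarith
  · simp
  · have := hconv.slope_le_of_hasDerivAt (Set.mem_univ _) (Set.mem_univ _) h (hg θ)
    rw [slope_def_field, div_le_iff₀ (sub_pos.2 h)] at this
    linarith

/-- Sub-Gaussianity of an exponential dispersion family variable with bounded `b''`. -/
theorem stmt3 (φ U : ℝ) (hφ : 0 < φ) (μ : Measure ℝ) (b : ℝ → ℝ)
    (hb : Differentiable ℝ b) (hb' : Differentiable ℝ (deriv b))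
    (hU : ∀ s : ℝ, deriv (deriv b) s ≤ U)
    (hnorm : ∀ s : ℝ, ∫ y, Real.exp ((y * s - b s) / φ) ∂μ = 1) :
    ∀ θ t : ℝ,
      ∫ y, Real.exp ((y * θ - b θ) / φ) * Real.exp (t * (y - deriv b θ)) ∂μ
        ≤ Real.exp (φ * U * t ^ 2 / 2) := by
  intro θ t
  have htilt (y : ℝ) : Real.exp ((y * θ - b θ) / φ) * Real.exp (t * (y - deriv b θ)) =
      Real.exp ((b (θ + φ * t) - b θ) / φ - t * deriv b θ) *
        Real.exp ((y * (θ + φ * t) - b (θ + φ * t)) / φ) := by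
    rw [← Real.exp_add, ← Real.exp_add]
    congr 1
    field_simp
    ring
  simp_rw [htilt]
  rw [integral_const_mul, hnorm, mul_one, Real.exp_le_exp, sub_le_iff_le_add, div_le_iff₀ hφ]
  have := le_quadratic_of_deriv2_le hb hb' hU θ (θ + φ * t)
  rw [add_sub_cancel_left] at this
  linarith
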